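/- Let K be an imaginary quadratic field, O an order in K of discriminant D_O, and N a positive integer. Let Q = ax² + bxy + cy² ∈ Q(D_O, N), set 𝔠 = ℤω_Q + ℤ, let [𝔠] be its class in C_N(O), and let P = {λ ∈ a𝔠̄ : λ ≠ 0 and λ ≡ 1 (mod NO)}, where 𝔠̄ is the image of 𝔠 under complex conjugation (note a𝔠̄ ⊆ O). Then: (i) [𝔠] ∩ M(O, N) = {λ𝔠 : λ ∈ P}; (ii) for λ, μ ∈ P one has λ𝔠 = μ𝔠 if and only if μ = ζλ for some unit ζ ∈ O^× with ζ ≡ 1 (mod NO). -/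

import Mathlib

open scoped nonZeroDivisors

set_option synthInstance.maxHeartbeats 1000000
set_option maxHeartbeats 1000000

noncomputable section

/-- `√D := i√|D|` for a negative integer `D`. -/
def sqrtD (D : ℤ) : ℂ := Complex.I * Real.sqrt (Int.natAbs D)

/-- `τ_O`: `√D/2` if `D ≡ 0 (mod 4)`, and `(-1+√D)/2` if `D ≡ 1 (mod 4)`. -/
def tauD (D : ℤ) : ℂ := if D % 4 = 0 then sqrtD D / 2 else (-1 + sqrtD D) / 2

/-- The order `O = ℤτ_O + ℤ = ℤ[τ_O]` of discriminant `D` in the imaginary quadratic field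
`K = ℚ(√D) ⊆ ℂ`. -/
def OD (D : ℤ) : Subalgebra ℤ ℂ := Algebra.adjoin ℤ {tauD D}

/-- Fractional `O`-ideals (inside `ℂ ⊇ K`; every fractional `O`-ideal lies in `K`). -/
abbrev Frac (O : Subalgebra ℤ ℂ) := FractionalIdeal ((O : Type))⁰ ℂ

/-- A nonzero ideal `a` of `O` is *prime to* `m` if `a + mO = O`. -/
def primeTo (O : Subalgebra ℤ ℂ) (m : ℕ) (a : Ideal O) : Prop :=
  a ⊔ Ideal.span {(m : (O : Type))} = ⊤

/-- `M(O, m)`: the nonzero proper (equivalently, invertible) `O`-ideals prime to `m`. -/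
def Mset (O : Subalgebra ℤ ℂ) (m : ℕ) : Set (Ideal O) :=
  {a | a ≠ 0 ∧ primeTo O m a ∧ IsUnit (a : Frac O)}

/-- `I(O, m)`: the subgroup of invertible fractional `O`-ideals generated by `M(O, m)`. -/
def Igrp (O : Subalgebra ℤ ℂ) (m : ℕ) : Subgroup (Frac O)ˣ :=
  Subgroup.closure {u | ∃ a ∈ Mset O m, (u : Frac O) = a}

/-- `P_N(O)`: the subgroup generated by the principal ideals `νO` with `ν ∈ O` nonzero and
`ν ≡ 1 (mod NO)`. -/
def Pgrp (O : Subalgebra ℤ ℂ) (N : ℕ) : Subgroup (Frac O)ˣ :=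
  Subgroup.closure {u | ∃ ν : (O : Type), ν ≠ 0 ∧
    (∃ μ : (O : Type), ν = 1 + (N : (O : Type)) * μ) ∧
    (u : Frac O) = ((Ideal.span {ν} : Ideal O) : Frac O)}

/-- The ray class group `C_N(O) = I(O, N)/P_N(O)`. -/
abbrev ClsGrp (O : Subalgebra ℤ ℂ) (N : ℕ) :=
  (Igrp O N) ⧸ ((Pgrp O N).subgroupOf (Igrp O N))

/-- The underlying set (in `ℂ`) of an invertible fractional ideal. -/
def fracSet {O : Subalgebra ℤ ℂ} (u : (Frac O)ˣ) : Set ℂ :=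
  (((u : Frac O) : Submodule (O : Type) ℂ) : Set ℂ)

/-- An integral binary quadratic form `a x² + b x y + c y²`. -/
structure QF where
  a : ℤ
  b : ℤ
  c : ℤ

/-- The discriminant `b² - 4ac`. -/
def QF.disc (Q : QF) : ℤ := Q.b ^ 2 - 4 * Q.a * Q.c

/-- `Q ∈ 𝒬(D)`: primitive positive definite of discriminant `D`. -/
def IsForm (D : ℤ) (Q : QF) : Prop :=
  Int.gcd Q.a (Int.gcd Q.b Q.c) = 1 ∧ Q.disc = D ∧ 0 < Q.a

/-- `Q ∈ 𝒬(D, N)`: additionally `gcd(a, N) = 1`. -/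
def IsFormN (D : ℤ) (N : ℕ) (Q : QF) : Prop := IsForm D Q ∧ Int.gcd Q.a N = 1

/-- `ω_Q = (-b + √D)/(2a)`, the root of `Q(x, 1)` in the upper half-plane. -/
def omegaQ (D : ℤ) (Q : QF) : ℂ := (-(Q.b : ℂ) + sqrtD D) / (2 * Q.a)

/-- The lattice `ℤω + ℤ`, as a subset of `ℂ`. -/
def latticeSet (ω : ℂ) : Set ℂ := {z : ℂ | ∃ m n : ℤ, z = (m : ℂ) * ω + (n : ℂ)}

/-!
STATEMENT 15: with `𝔠 = ℤω_Q + ℤ`, `[𝔠] = C ∈ C_N(O)` and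
`P = {λ ∈ a𝔠̄ : λ ≠ 0, λ ≡ 1 (mod NO)}` (note `a𝔠̄ ⊆ O`):
(i) `[𝔠] ∩ M(O,N) = {λ𝔠 : λ ∈ P}`;
(ii) for `λ, μ ∈ P`: `λ𝔠 = μ𝔠` iff `μ = ζλ` for some `ζ ∈ O^×` with `ζ ≡ 1 (mod NO)`.
Ideals are compared through their underlying subsets of `ℂ`, and `λ𝔠` is the subset
`λ · (ℤω_Q + ℤ)` of `ℂ`.
-/

lemma sqrtD_sq (D : ℤ) (hD : D < 0) : sqrtD D ^ 2 = (D : ℂ) := by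
  unfold sqrtD
  have h1 : ((Real.sqrt (Int.natAbs D) : ℝ) : ℂ) ^ 2 = ((Int.natAbs D : ℝ) : ℂ) := by
    rw [← Complex.ofReal_pow, Real.sq_sqrt (by positivity)]
  rw [mul_pow, Complex.I_sq, h1]
  have h2 : ((Int.natAbs D : ℤ)) = -D := by omega
  have h3 : ((Int.natAbs D : ℝ) : ℂ) = -(D : ℂ) := by
    have := congrArg (fun x : ℤ => (x : ℂ)) h2
    push_cast at this ⊢
    simpa using this
  rw [h3]; ring

lemma sqrtD_im (D : ℤ) (hD : D < 0) : (sqrtD D).im ≠ 0 := by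
  unfold sqrtD
  simp
  omega

lemma sqrtD_conj (D : ℤ) : (starRingEnd ℂ) (sqrtD D) = - sqrtD D := by
  unfold sqrtD
  simp

lemma mem_OD (D : ℤ) (hD : D < 0) (b e : ℤ)
    (hb : b ^ 2 - 4 * e = D) (z : ℂ) :
    z ∈ OD D ↔ ∃ x y : ℤ, z = x + y * ((-(b : ℂ) + sqrtD D) / 2) := by
  have hs := sqrtD_sq D hD
  have hbD : (D : ℂ) = (b : ℂ) ^ 2 - 4 * e := by rw [← hb]; push_cast; ring
  rw [hbD] at hs
  have ht : ∃ k : ℤ, tauD D = (-(b : ℂ) + sqrtD D) / 2 + k := by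
    unfold tauD
    rcases Int.even_or_odd' b with ⟨k, hk | hk⟩
    · have : D % 4 = 0 := by
        rw [← hb, hk]; ring_nf; omega
      rw [if_pos this]
      exact ⟨k, by rw [hk]; push_cast; ring⟩
    · have : D % 4 ≠ 0 := by
        rw [← hb, hk]; ring_nf; omega
      rw [if_neg this]
      exact ⟨k, by rw [hk]; push_cast; ring⟩
  obtain ⟨k, hk⟩ := ht
  constructor
  · intro hz
    unfold OD at hz
    induction hz using Algebra.adjoin_induction with
    | mem x hx =>
      rw [Set.mem_singleton_iff] at hx
      exact ⟨k, 1, by rw [hx, hk]; push_cast; ring⟩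
    | algebraMap r => exact ⟨r, 0, by simp⟩
    | add x y _ _ hx hy =>
      obtain ⟨x1, x2, rfl⟩ := hx
      obtain ⟨y1, y2, rfl⟩ := hy
      exact ⟨x1 + y1, x2 + y2, by push_cast; ring⟩
    | mul x y _ _ hx hy =>
      obtain ⟨x1, x2, rfl⟩ := hx
      obtain ⟨y1, y2, rfl⟩ := hy
      refine ⟨x1 * y1 - x2 * y2 * e, x1 * y2 + x2 * y1 - x2 * y2 * b, ?_⟩
      push_cast
      linear_combination ((x2 : ℂ) * y2 / 4) * hs
  · rintro ⟨x, y, rfl⟩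
    have h1 : tauD D ∈ OD D := Algebra.subset_adjoin rfl
    have h2 : (-(b : ℂ) + sqrtD D) / 2 = tauD D - k := by rw [hk]; ring
    rw [h2]
    exact add_mem (intCast_mem _ _) (mul_mem (intCast_mem _ _) (sub_mem h1 (intCast_mem _ _)))

lemma mem_smul (O : Subalgebra ℤ ℂ) (l : O) (J : Frac O) (z : ℂ) :
    z ∈ ((((Ideal.span {l} : Ideal O) : Frac O) * J : Frac O) : Submodule O ℂ) ↔
      ∃ w ∈ (J : Submodule O ℂ), z = (l : ℂ) * w := by
  rw [FractionalIdeal.coe_mul, FractionalIdeal.coe_coeIdeal,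
    IsLocalization.coeSubmodule_span_singleton, Submodule.mem_span_singleton_mul]
  exact ⟨fun ⟨w, hw, h⟩ => ⟨w, hw, h.symm⟩, fun ⟨w, hw, h⟩ => ⟨w, hw, h.symm⟩⟩

lemma span_unit (O : Subalgebra ℤ ℂ) (l : O) (hl : l ≠ 0) :
    IsUnit ((Ideal.span {l} : Ideal O) : Frac O) := by
  have hl' : (l : ℂ) ≠ 0 := fun h => hl (Subtype.ext h)
  let J : Frac O := ⟨Submodule.span O {(l : ℂ)⁻¹}, l, mem_nonZeroDivisors_of_ne_zero hl, by
    intro b hb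
    obtain ⟨c, rfl⟩ := Submodule.mem_span_singleton.1 hb
    refine ⟨c, ?_⟩
    change (c : ℂ) = (l : ℂ) * ((c : ℂ) * (l : ℂ)⁻¹)
    field_simp⟩
  refine IsUnit.of_mul_eq_one J ?_
  apply FractionalIdeal.coeToSubmodule_injective
  ext z
  rw [mem_smul]
  change _ ↔ z ∈ ((1 : Frac O) : Submodule O ℂ)
  rw [FractionalIdeal.coe_one]
  constructor
  · rintro ⟨w, hw, rfl⟩
    obtain ⟨c, rfl⟩ := Submodule.mem_span_singleton.1 hw
    refine Submodule.mem_one.2 ⟨c, ?_⟩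
    change (c : ℂ) = (l : ℂ) * ((c : ℂ) * (l : ℂ)⁻¹)
    field_simp
  · intro hz
    obtain ⟨c, rfl⟩ := Submodule.mem_one.1 hz
    refine ⟨c • (l : ℂ)⁻¹, Submodule.mem_span_singleton.2 ⟨c, rfl⟩, ?_⟩
    change (c : ℂ) = (l : ℂ) * ((c : ℂ) * (l : ℂ)⁻¹)
    field_simp

lemma mem_Pgrp (O : Subalgebra ℤ ℂ) (N : ℕ) (p : (Frac O)ˣ) (hp : p ∈ Pgrp O N) :
    ∃ ν ν' : O, ν ≠ 0 ∧ ν' ≠ 0 ∧ (∃ μ : O, ν = 1 + (N : O) * μ) ∧ (∃ μ : O, ν' = 1 + (N : O) * μ) ∧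
      ((Ideal.span {ν'} : Ideal O) : Frac O) * (p : Frac O)
        = ((Ideal.span {ν} : Ideal O) : Frac O) := by
  unfold Pgrp at hp
  induction hp using Subgroup.closure_induction with
  | mem x hx =>
    obtain ⟨ν, h0, h1, h2⟩ := hx
    refine ⟨ν, 1, h0, one_ne_zero, h1, ⟨0, by simp⟩, ?_⟩
    rw [h2, Ideal.span_singleton_one]
    simp
  | one => exact ⟨1, 1, one_ne_zero, one_ne_zero, ⟨0, by simp⟩, ⟨0, by simp⟩, by simp⟩
  | mul x y _ _ hx hy =>
    obtain ⟨a, a', h1, h2, ⟨m, h3⟩, ⟨m', h4⟩, h5⟩ := hx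
    obtain ⟨b, b', k1, k2, ⟨n, k3⟩, ⟨n', k4⟩, k5⟩ := hy
    refine ⟨a * b, a' * b', mul_ne_zero h1 k1, mul_ne_zero h2 k2,
      ⟨m + n + N * m * n, by rw [h3, k3]; ring⟩, ⟨m' + n' + N * m' * n', by rw [h4, k4]; ring⟩, ?_⟩
    rw [← Ideal.span_singleton_mul_span_singleton, ← Ideal.span_singleton_mul_span_singleton,
      FractionalIdeal.coeIdeal_mul, FractionalIdeal.coeIdeal_mul, ← h5, ← k5, Units.val_mul]
    ring
  | inv x _ hx =>
    obtain ⟨a, a', h1, h2, h3, h4, h5⟩ := hx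
    refine ⟨a', a, h2, h1, h4, h3, ?_⟩
    rw [← h5, mul_assoc, Units.mul_inv, mul_one]

lemma frac_ext (O : Subalgebra ℤ ℂ) (I J : Frac O)
    (h : ∀ z, z ∈ (I : Submodule O ℂ) ↔ z ∈ (J : Submodule O ℂ)) : I = J :=
  FractionalIdeal.coeToSubmodule_injective (Submodule.ext h)

lemma mem_coeI (O : Subalgebra ℤ ℂ) (a : Ideal O) (z : ℂ) :
    z ∈ ((a : Frac O) : Submodule O ℂ) ↔ z ∈ Subtype.val '' (a : Set O) := by
  rw [FractionalIdeal.coe_coeIdeal, IsLocalization.mem_coeSubmodule]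
  rfl

theorem statement15 (D : ℤ) (hD : D < 0) (hD4 : D % 4 = 0 ∨ D % 4 = 1) (N : ℕ) (hN : 0 < N)
    (Q : QF) (hQ : IsFormN D N Q) (C : ClsGrp (OD D) N)
    (hC : ∃ (u : (Frac (OD D))ˣ) (hu : u ∈ Igrp (OD D) N),
      fracSet u = latticeSet (omegaQ D Q) ∧ QuotientGroup.mk ⟨u, hu⟩ = C) :
    -- `a𝔠̄ ⊆ O`:
    (∀ z : ℂ, (∃ w ∈ latticeSet ((starRingEnd ℂ) (omegaQ D Q)), z = (Q.a : ℂ) * w) →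
        z ∈ OD D) ∧
    -- (i)  `[𝔠] ∩ M(O, N) = {λ𝔠 : λ ∈ P}`:
    (∀ a : Ideal (OD D),
      (a ∈ Mset (OD D) N ∧ ∃ (u : (Frac (OD D))ˣ) (hu : u ∈ Igrp (OD D) N),
          (u : Frac (OD D)) = (a : Frac (OD D)) ∧ QuotientGroup.mk ⟨u, hu⟩ = C) ↔
        (∃ lam : ((OD D : Subalgebra ℤ ℂ) : Type),
          ((lam : ℂ) ∈ {z : ℂ | ∃ w ∈ latticeSet ((starRingEnd ℂ) (omegaQ D Q)),
              z = (Q.a : ℂ) * w} ∧ lam ≠ 0 ∧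
            (∃ μ : ((OD D : Subalgebra ℤ ℂ) : Type),
              lam = 1 + (N : ((OD D : Subalgebra ℤ ℂ) : Type)) * μ)) ∧
          Subtype.val '' (a : Set ((OD D : Subalgebra ℤ ℂ) : Type)) =
            {z : ℂ | ∃ w ∈ latticeSet (omegaQ D Q), z = (lam : ℂ) * w})) ∧
    -- (ii) for `λ, μ ∈ P`, `λ𝔠 = μ𝔠 ↔ μ = ζλ` for a unit `ζ ≡ 1 (mod NO)`:
    (∀ lam mu : ((OD D : Subalgebra ℤ ℂ) : Type),
      ((lam : ℂ) ∈ {z : ℂ | ∃ w ∈ latticeSet ((starRingEnd ℂ) (omegaQ D Q)),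
          z = (Q.a : ℂ) * w} ∧ lam ≠ 0 ∧
        (∃ μ : ((OD D : Subalgebra ℤ ℂ) : Type),
          lam = 1 + (N : ((OD D : Subalgebra ℤ ℂ) : Type)) * μ)) →
      ((mu : ℂ) ∈ {z : ℂ | ∃ w ∈ latticeSet ((starRingEnd ℂ) (omegaQ D Q)),
          z = (Q.a : ℂ) * w} ∧ mu ≠ 0 ∧
        (∃ μ : ((OD D : Subalgebra ℤ ℂ) : Type),
          mu = 1 + (N : ((OD D : Subalgebra ℤ ℂ) : Type)) * μ)) →
      ({z : ℂ | ∃ w ∈ latticeSet (omegaQ D Q), z = (lam : ℂ) * w} =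
          {z : ℂ | ∃ w ∈ latticeSet (omegaQ D Q), z = (mu : ℂ) * w} ↔
        ∃ ζ : ((OD D : Subalgebra ℤ ℂ) : Type)ˣ,
          (∃ k : ((OD D : Subalgebra ℤ ℂ) : Type),
            (ζ : ((OD D : Subalgebra ℤ ℂ) : Type)) =
              1 + (N : ((OD D : Subalgebra ℤ ℂ) : Type)) * k) ∧
          mu = (ζ : ((OD D : Subalgebra ℤ ℂ) : Type)) * lam)) := by
  obtain ⟨u, hu, hset, hCu⟩ := hC
  obtain ⟨⟨hgcd, hdisc, hapos⟩, hcop⟩ := hQ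
  have ha0 : (Q.a : ℂ) ≠ 0 := by exact_mod_cast hapos.ne'
  have hO := mem_OD D hD Q.b (Q.a * Q.c) (by rw [← hdisc]; unfold QF.disc; ring)
  have hs := sqrtD_sq D hD
  have hDc : (D : ℂ) = (Q.b : ℂ) ^ 2 - 4 * Q.a * Q.c := by
    rw [← hdisc]; unfold QF.disc; push_cast; ring
  rw [hDc] at hs
  have hβ : (-(Q.b : ℂ) + sqrtD D) / 2 = Q.a * omegaQ D Q := by
    unfold omegaQ; field_simp
  rw [hβ] at hO
  have hconj : (starRingEnd ℂ) (omegaQ D Q) = (-(Q.b : ℂ) - sqrtD D) / (2 * Q.a) := by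
    unfold omegaQ
    have h2 : (starRingEnd ℂ) 2 = 2 := Complex.conj_ofNat 2
    simp [sqrtD_conj, h2]
    ring
  have hconj1 : (Q.a : ℂ) * (starRingEnd ℂ) (omegaQ D Q) = - Q.b - Q.a * omegaQ D Q := by
    rw [hconj, ← hβ]; field_simp; ring
  have hconj2 : (Q.a : ℂ) * (starRingEnd ℂ) (omegaQ D Q) * omegaQ D Q = Q.c := by
    rw [hconj]; unfold omegaQ; field_simp; linear_combination -hs
  have him : (omegaQ D Q).im ≠ 0 := by
    intro h
    apply sqrtD_im D hD
    have h3 : sqrtD D = ((2 * Q.a : ℤ) : ℂ) * omegaQ D Q + (Q.b : ℤ) := by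
      unfold omegaQ; push_cast; field_simp; ring
    rw [h3, Complex.add_im, Complex.intCast_im, Complex.mul_im, h, Complex.intCast_im]
    simp
  have hmemu : ∀ z, z ∈ ((u : Frac (OD D)) : Submodule (OD D) ℂ) ↔ z ∈ latticeSet (omegaQ D Q) := by
    intro z; rw [← hset]; rfl
  have h1c : (1 : ℂ) ∈ latticeSet (omegaQ D Q) := ⟨0, 1, by simp⟩
  have hwc : omegaQ D Q ∈ latticeSet (omegaQ D Q) := ⟨1, 0, by simp⟩
  have hlu : ∀ (l : OD D) (z : ℂ),
      z ∈ ((((Ideal.span {l} : Ideal (OD D)) : Frac (OD D)) * (u : Frac (OD D)) : Frac (OD D)) :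
        Submodule (OD D) ℂ) ↔ z ∈ {z : ℂ | ∃ w ∈ latticeSet (omegaQ D Q), z = (l : ℂ) * w} := by
    intro l z
    rw [mem_smul]
    simp only [hmemu, Set.mem_ofPred_eq]
  refine ⟨?_, ?_, ?_⟩
  · rintro z ⟨w, ⟨m, n, rfl⟩, rfl⟩
    rw [hO]
    refine ⟨-m * Q.b + Q.a * n, -m, ?_⟩
    push_cast
    linear_combination (m : ℂ) * hconj1
  · intro a
    constructor
    · rintro ⟨haM, v, hv, hva, hvC⟩
      rw [← hCu] at hvC
      have hp : u⁻¹ * v ∈ Pgrp (OD D) N := by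
        have := QuotientGroup.eq.1 hvC.symm
        rw [Subgroup.mem_subgroupOf] at this
        exact this
      obtain ⟨ν, ν', h1, h2, ⟨m, h3⟩, ⟨m', h4⟩, h5⟩ := mem_Pgrp _ _ _ hp
      have h2' : (ν' : ℂ) ≠ 0 := fun h => h2 (Subtype.ext h)
      have h6 : ((Ideal.span {ν'} : Ideal (OD D)) : Frac (OD D)) * (a : Frac (OD D)) =
          ((Ideal.span {ν} : Ideal (OD D)) : Frac (OD D)) * (u : Frac (OD D)) := by
        rw [← h5, ← hva, Units.val_mul]
        rw [mul_assoc, mul_right_comm (u⁻¹ : (Frac (OD D))ˣ).val, Units.inv_mul, one_mul]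
      have h7 : ∀ z : ℂ, (∃ w ∈ Subtype.val '' (a : Set (OD D)), z = (ν' : ℂ) * w) ↔
          ∃ w ∈ latticeSet (omegaQ D Q), z = (ν : ℂ) * w := by
        intro z
        have := hlu ν z
        rw [← h6, mem_smul] at this
        simpa only [mem_coeI, Set.mem_ofPred_eq] using this
      obtain ⟨_, ⟨lam, hlam, rfl⟩, e1⟩ := (h7 ν).2 ⟨1, h1c, by ring⟩
      obtain ⟨_, ⟨t, ht, rfl⟩, e2⟩ := (h7 (ν * omegaQ D Q)).2 ⟨_, hwc, rfl⟩
      have e3 : (lam : ℂ) * omegaQ D Q = t := by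
        apply mul_left_cancel₀ h2'
        rw [← e2, e1]; ring
      have e1' : ν = ν' * lam := Subtype.ext e1
      refine ⟨lam, ⟨?_, ?_, ?_⟩, ?_⟩
      · obtain ⟨x, y, hxy⟩ := (hO lam).1 lam.2
        obtain ⟨x', y', hxy'⟩ := (hO t).1 t.2
        -- rewrite in terms of the conjugate
        have k1 : (lam : ℂ) = ((x - y * Q.b : ℤ) : ℂ) -
            y * (Q.a * (starRingEnd ℂ) (omegaQ D Q)) := by
          rw [hconj1, hxy]; push_cast; ring
        have k2 : ((x - y * Q.b - y' * Q.a : ℤ) : ℂ) * omegaQ D Q = ((x' + y * Q.c : ℤ) : ℂ) := by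
          rw [k1, hxy'] at e3
          push_cast at e3 ⊢
          linear_combination e3 + (y : ℂ) * hconj2
        have k3 := congrArg Complex.im k2
        rw [Complex.mul_im, Complex.intCast_im, Complex.intCast_im, Complex.intCast_re, zero_mul,
          add_zero] at k3
        have k4 : x - y * Q.b - y' * Q.a = 0 := by
          have := (mul_eq_zero.1 k3).resolve_right him
          exact_mod_cast this
        refine ⟨(-y : ℤ) * (starRingEnd ℂ) (omegaQ D Q) + (y' : ℤ), ⟨-y, y', rfl⟩, ?_⟩
        rw [k1, show x - y * Q.b = y' * Q.a by linarith]
        push_cast; ring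
      · rintro rfl
        exact h1 (by rw [e1', mul_zero])
      · refine ⟨m - lam * m', ?_⟩
        rw [h3, h4] at e1'
        linear_combination -e1'
      · ext z
        have h8 := h7 (ν' * z)
        constructor
        · intro hz
          obtain ⟨w, hw, e⟩ := h8.1 ⟨z, hz, rfl⟩
          refine ⟨w, hw, mul_left_cancel₀ h2' ?_⟩
          rw [e, e1]; ring
        · rintro ⟨w, hw, rfl⟩
          obtain ⟨w', hw', e⟩ := h8.2 ⟨w, hw, by rw [e1]; ring⟩
          rw [mul_left_cancel₀ h2' e]; exact hw'
    · rintro ⟨lam, ⟨hlc, hl0, m, hm⟩, hset2⟩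
      have hfr : (a : Frac (OD D)) =
          ((Ideal.span {lam} : Ideal (OD D)) : Frac (OD D)) * (u : Frac (OD D)) := by
        apply frac_ext
        intro z
        rw [hlu, mem_coeI, hset2]
      have hla : lam ∈ a := by
        have : (lam : ℂ) ∈ Subtype.val '' (a : Set (OD D)) := by
          rw [hset2]; exact ⟨1, h1c, by ring⟩
        obtain ⟨t, ht, e⟩ := this
        rwa [← Subtype.ext e]
      have hsu := span_unit (OD D) lam hl0
      have hau : IsUnit (a : Frac (OD D)) := by
        rw [hfr]; exact hsu.mul u.isUnit
      have haM : a ∈ Mset (OD D) N := by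
        refine ⟨?_, ?_, hau⟩
        · rintro rfl
          exact hl0 (by simpa using hla)
        · unfold primeTo
          rw [Ideal.eq_top_iff_one]
          have e : (1 : OD D) = lam + (-m) * (N : OD D) := by rw [hm]; ring
          rw [e]
          exact add_mem (Ideal.mem_sup_left hla) (Ideal.mem_sup_right
            (Ideal.mul_mem_left _ _ (Ideal.subset_span rfl)))
      have hvI : hau.unit ∈ Igrp (OD D) N := Subgroup.subset_closure ⟨a, haM, rfl⟩
      refine ⟨haM, hau.unit, hvI, rfl, ?_⟩
      rw [← hCu]
      symm
      apply QuotientGroup.eq.2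
      rw [Subgroup.mem_subgroupOf]
      change u⁻¹ * hau.unit ∈ Pgrp (OD D) N
      apply Subgroup.subset_closure
      refine ⟨lam, hl0, ⟨m, hm⟩, ?_⟩
      rw [Units.val_mul, IsUnit.unit_spec, hfr, mul_left_comm, Units.inv_mul, mul_one]
  · rintro lam mu ⟨-, hl0, m, hm⟩ ⟨-, hm0, m', hm'⟩
    have hl0' : (lam : ℂ) ≠ 0 := fun h => hl0 (Subtype.ext h)
    constructor
    · intro heq
      have h1 : ((Ideal.span {lam} : Ideal (OD D)) : Frac (OD D)) * (u : Frac (OD D)) =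
          ((Ideal.span {mu} : Ideal (OD D)) : Frac (OD D)) * (u : Frac (OD D)) := by
        apply frac_ext
        intro z
        rw [hlu, hlu, heq]
      have h2 := u.isUnit.mul_right_cancel h1
      have h3 : ∀ z : ℂ, z ∈ Subtype.val '' ((Ideal.span {lam} : Ideal (OD D)) : Set (OD D)) ↔
          z ∈ Subtype.val '' ((Ideal.span {mu} : Ideal (OD D)) : Set (OD D)) := by
        intro z
        rw [← mem_coeI, ← mem_coeI, h2]
      have h4 : Ideal.span {lam} = Ideal.span {mu} := by
        ext x
        simpa using h3 x
      obtain ⟨ζ, hζ⟩ := Ideal.span_singleton_eq_span_singleton.1 h4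
      refine ⟨ζ, ⟨m' - ζ * m, ?_⟩, by rw [← hζ, mul_comm]⟩
      rw [hm, hm'] at hζ
      linear_combination hζ
    · rintro ⟨ζ, -, rfl⟩
      have h4 : Ideal.span {lam} = Ideal.span {(ζ : OD D) * lam} := by
        rw [Ideal.span_singleton_eq_span_singleton]
        exact ⟨ζ, mul_comm _ _⟩
      ext z
      rw [← hlu, ← hlu, h4]
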